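/- arXiv:1611.01524 — 7 statements merged into one kernel-verified Lean document; each statement's English description precedes it below -/
import Mathlib

section
/- (Proposition 1) For every real k×n matrix W with columns w_1, …, w_n, the aggregated penalized objective of n mimicking investors satisfies Σᵢ βᵢ [ wᵢ'μ − (αᵢ/2) wᵢ'Σwᵢ − (φᵢ/2)(wᵢ − Wβ)'Σ(wᵢ − Wβ) ] = β'W'μ − (1/2) tr(A W'ΣW), where A = (A₀ + Φ)B + (φ̄ I − 2Φ) ββ' is the n×n mimicking matrix. -/
open Matrix BigOperators

/-- Proposition 1: For every k×n matrix `W` with columns `w₁,…,wₙ`,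
`Σᵢ βᵢ [wᵢ'μ − (αᵢ/2) wᵢ'Σwᵢ − (φᵢ/2)(wᵢ − Wβ)'Σ(wᵢ − Wβ)]
  = β'W'μ − (1/2) tr(A W'ΣW)`, where `A = (A₀ + Φ)B + (φ̄ I − 2Φ)ββ'`. -/
theorem aggregated_mimicking_objective_mean_variance_form
    {k n : ℕ} (hk : 2 ≤ k) (hn : 2 ≤ n)
    (S : Matrix (Fin k) (Fin k) ℝ) (hS : S.PosDef)
    (μ : Fin k → ℝ)
    (α β φ : Fin n → ℝ)
    (hα : ∀ i, 0 < α i) (hβ : ∀ i, 0 < β i) (hβsum : ∑ i, β i = 1)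
    (hφ : ∀ i, 0 < φ i)
    (W : Matrix (Fin k) (Fin n) ℝ) :
    let A₀ : Matrix (Fin n) (Fin n) ℝ := Matrix.diagonal α
    let B : Matrix (Fin n) (Fin n) ℝ := Matrix.diagonal β
    let Φ : Matrix (Fin n) (Fin n) ℝ := Matrix.diagonal φ
    let φbar : ℝ := ∑ i, β i * φ i
    let A : Matrix (Fin n) (Fin n) ℝ :=
      (A₀ + Φ) * B + (φbar • (1 : Matrix (Fin n) (Fin n) ℝ) - 2 • Φ) * vecMulVec β β
    (∑ i, β i * ((Wᵀ i) ⬝ᵥ μ - (α i / 2) * ((Wᵀ i) ⬝ᵥ (S *ᵥ (Wᵀ i)))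
        - (φ i / 2) * ((Wᵀ i - W *ᵥ β) ⬝ᵥ (S *ᵥ (Wᵀ i - W *ᵥ β)))))
      = β ⬝ᵥ (Wᵀ *ᵥ μ) - (1 / 2) * (A * Wᵀ * S * W).trace := by
  intro A₀ B Φ φbar A
  have hsymm : Sᵀ = S := by
    have h := hS.isHermitian
    rwa [Matrix.IsHermitian, Matrix.conjTranspose_eq_transpose_of_trivial] at h
  have hcomm : ∀ u v : Fin k → ℝ, u ⬝ᵥ (S *ᵥ v) = v ⬝ᵥ (S *ᵥ u) := by
    intro u v
    rw [Matrix.dotProduct_mulVec, ← Matrix.mulVec_transpose, hsymm, dotProduct_comm]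
  have hWb : ∀ v : Fin k → ℝ, (W *ᵥ β) ⬝ᵥ v = ∑ i, β i * ((Wᵀ i) ⬝ᵥ v) := by
    intro v
    rw [dotProduct_comm, Matrix.dotProduct_mulVec, ← Matrix.mulVec_transpose, dotProduct_comm]
    rfl
  have hG : ∀ i j, (Wᵀ * S * W) i j = (Wᵀ i) ⬝ᵥ (S *ᵥ (Wᵀ j)) := by
    intro i j
    rw [Matrix.mul_assoc]
    rfl
  have htr : (A * Wᵀ * S * W).trace = ∑ i, ((α i + φ i) * β i * ((Wᵀ i) ⬝ᵥ (S *ᵥ (Wᵀ i)))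
      + (φbar - 2 * φ i) * β i * ((Wᵀ i) ⬝ᵥ (S *ᵥ (W *ᵥ β)))) := by
    have h1 : A * Wᵀ * S * W = A * (Wᵀ * S * W) := by simp only [Matrix.mul_assoc]
    rw [h1, Matrix.trace]
    refine Finset.sum_congr rfl fun i _ => ?_
    have hA : ∀ j, A i j = (if i = j then (α i + φ i) * β i else 0)
        + (φbar - 2 * φ i) * β i * β j := by
      intro j
      have hD : A = Matrix.diagonal (fun i => (α i + φ i) * β i)
          + Matrix.diagonal (fun i => φbar - 2 * φ i) * vecMulVec β β := by
        simp only [A, A₀, B, Φ]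
        congr 1
        · rw [Matrix.diagonal_add, Matrix.diagonal_mul_diagonal]
        · congr 1
          ext a b
          by_cases h : a = b
          · subst h; simp [two_nsmul, two_mul, -nsmul_eq_mul]
          · simp [h, two_nsmul, -nsmul_eq_mul]
      rw [hD, Matrix.add_apply, Matrix.diagonal_mul, Matrix.diagonal_apply, vecMulVec_apply]
      ring
    rw [Matrix.diag_apply, Matrix.mul_apply, hcomm _ (W *ᵥ β), hWb]
    simp only [hA, hG, add_mul, Finset.sum_add_distrib, ite_mul, zero_mul, Finset.sum_ite_eq,
      Finset.mem_univ, if_true, Finset.mul_sum]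
    congr 1
    refine Finset.sum_congr rfl fun j _ => ?_
    rw [hcomm (Wᵀ j)]
    rw [hcomm (Wᵀ i)]
    ring
  have hlin : β ⬝ᵥ (Wᵀ *ᵥ μ) = ∑ i, β i * ((Wᵀ i) ⬝ᵥ μ) := rfl
  have hq := hWb (S *ᵥ (W *ᵥ β))
  have hexp : ∀ i, (Wᵀ i - W *ᵥ β) ⬝ᵥ (S *ᵥ (Wᵀ i - W *ᵥ β))
      = (Wᵀ i) ⬝ᵥ (S *ᵥ (Wᵀ i)) - 2 * ((Wᵀ i) ⬝ᵥ (S *ᵥ (W *ᵥ β)))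
        + (W *ᵥ β) ⬝ᵥ (S *ᵥ (W *ᵥ β)) := by
    intro i
    rw [Matrix.mulVec_sub, sub_dotProduct, dotProduct_sub, dotProduct_sub,
      hcomm (W *ᵥ β) (Wᵀ i)]
    ring
  simp only [hexp]
  rw [htr, hlin]
  generalize (W *ᵥ β) ⬝ᵥ (S *ᵥ (W *ᵥ β)) = q at *
  have key : ∑ i, (β i * φ i) * q = ∑ i, φbar * (β i * ((Wᵀ i) ⬝ᵥ (S *ᵥ (W *ᵥ β)))) := by
    rw [← Finset.sum_mul, ← Finset.mul_sum, ← hq]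
  have : ∀ x y : ℝ, x = y → ∀ a b : ℝ, a + (1/2) * x = b + (1/2) * y → a = b := by
    intro x y h a b h2
    linarith
  refine this _ _ key _ _ ?_
  simp only [Finset.mul_sum, ← Finset.sum_sub_distrib, ← Finset.sum_add_distrib]
  refine Finset.sum_congr rfl fun i _ => ?_
  ring
end

section
/- (Theorem 1, positive definiteness) The symmetrized mimicking matrix A_φ = (A + A')/2, where A = (A₀ + Φ)B + (φ̄ I − 2Φ) ββ', is symmetric and positive definite. -/
open Matrix BigOperators

/-- Theorem 1, positive definiteness: The symmetrized mimicking matrix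
`A_φ = (A + A')/2`, with `A = (A₀ + Φ)B + (φ̄ I − 2Φ)ββ'`, is symmetric positive definite. -/
theorem mimicking_matrix_symm_posDef
    {n : ℕ} (hn : 2 ≤ n)
    (α β φ : Fin n → ℝ)
    (hα : ∀ i, 0 < α i) (hβ : ∀ i, 0 < β i) (hβsum : ∑ i, β i = 1)
    (hφ : ∀ i, 0 ≤ φ i) :
    let A₀ : Matrix (Fin n) (Fin n) ℝ := Matrix.diagonal α
    let B : Matrix (Fin n) (Fin n) ℝ := Matrix.diagonal β
    let Φ : Matrix (Fin n) (Fin n) ℝ := Matrix.diagonal φ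
    let φbar : ℝ := ∑ i, β i * φ i
    let A : Matrix (Fin n) (Fin n) ℝ :=
      (A₀ + Φ) * B + (φbar • (1 : Matrix (Fin n) (Fin n) ℝ) - 2 • Φ) * vecMulVec β β
    let Aφ : Matrix (Fin n) (Fin n) ℝ := (1 / 2 : ℝ) • (A + Aᵀ)
    Aφ.IsSymm ∧ Aφ.PosDef := by
  intro A₀ B Φ φbar A Aφ
  have hsymm : Aφ.IsSymm := by
    unfold Matrix.IsSymm
    simp only [Aφ, transpose_smul, transpose_add, transpose_transpose]
    rw [add_comm]
  refine ⟨hsymm, ?_⟩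
  let C : Matrix (Fin n) (Fin n) ℝ := Matrix.of fun k i => (if k = i then 1 else 0) - β i
  have key : Aφ = Matrix.diagonal (fun i => α i * β i)
      + Cᴴ * Matrix.diagonal (fun i => φ i * β i) * C := by
    ext i j
    have h1 : (Cᴴ * Matrix.diagonal (fun i => φ i * β i) * C) i j
        = (if i = j then φ i * β i else 0) - φ i * β i * β j - φ j * β j * β i
          + φbar * (β i * β j) := by
      rw [Matrix.mul_apply]
      simp only [Matrix.mul_diagonal, conjTranspose_apply, star_trivial, C, of_apply]
      have : ∀ k, ((if k = i then (1:ℝ) else 0) - β i) * (φ k * β k)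
            * ((if k = j then (1:ℝ) else 0) - β j)
          = (if k = i then (if i = j then φ i * β i else 0) else 0)
            - (if k = i then φ i * β i * β j else 0)
            - (if k = j then φ j * β j * β i else 0)
            + β k * φ k * (β i * β j) := by
        intro k
        by_cases h : k = i
        · subst h
          by_cases h' : k = j
          · subst h'
            simp
            ring
          · simp [h']
            ring
        · by_cases h' : k = j
          · subst h'
            simp [h]
            ring
          · simp [h, h']
            ring
      simp only [this, Finset.sum_add_distrib, Finset.sum_sub_distrib, ← Finset.sum_mul,
        Finset.sum_ite_eq', Finset.mem_univ, if_true, φbar]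
    have hA : ∀ i j, A i j = (if i = j then (α i + φ i) * β i else 0)
        + (φbar - 2 * φ i) * (β i * β j) := by
      intro i j
      simp only [A, A₀, B, Φ, sub_mul, Matrix.smul_mul, one_mul, Matrix.add_apply,
        Matrix.sub_apply, Matrix.smul_apply, diagonal_add, diagonal_mul_diagonal,
        diagonal_mul, vecMulVec_apply, diagonal_apply, smul_eq_mul, two_nsmul, add_mul]
      ring
    rw [Matrix.add_apply, h1]
    simp only [Aφ, Matrix.smul_apply, Matrix.add_apply, transpose_apply, hA, smul_eq_mul,
      diagonal_apply]
    by_cases h : i = j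
    · subst h
      simp
      ring
    · have h' : ¬ j = i := fun e => h e.symm
      simp [h, h']
      ring
  rw [key]
  refine Matrix.PosDef.add_posSemidef ?_ ?_
  · exact Matrix.PosDef.diagonal fun i => mul_pos (hα i) (hβ i)
  · exact Matrix.PosSemidef.conjTranspose_mul_mul_same
      (Matrix.PosSemidef.diagonal fun i => mul_nonneg (hφ i) (hβ i).le) C
end

section
/- (Theorem 1, optimal weights) The k×n matrix W* = ω_GMV 1_n' + (Qμ)(β' A_φ⁻¹) is the unique maximizer of the objective W ↦ β'W'μ − (1/2) tr(A W'ΣW) over all real k×n matrices W satisfying the constraint W'1_k = 1_n. -/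
open Matrix BigOperators


open scoped MatrixOrder in
lemma aux_factor {k : ℕ} (S : Matrix (Fin k) (Fin k) ℝ) (hS : S.PosDef) :
    ∃ R : Matrix (Fin k) (Fin k) ℝ, S = Rᵀ * R := by
  obtain ⟨R, hR⟩ := CStarAlgebra.nonneg_iff_eq_star_mul_self.mp hS.posSemidef.nonneg
  exact ⟨R, by simpa [star_eq_conjTranspose, conjTranspose_eq_transpose_of_trivial] using hR⟩

lemma aux_trace_pos {k n : ℕ} (S : Matrix (Fin k) (Fin k) ℝ) (hS : S.PosDef)
    (A : Matrix (Fin n) (Fin n) ℝ) (hA : ∀ x : Fin n → ℝ, x ≠ 0 → 0 < x ⬝ᵥ (A *ᵥ x))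
    (D : Matrix (Fin k) (Fin n) ℝ) (hD : D ≠ 0) : 0 < (A * Dᵀ * S * D).trace := by
  obtain ⟨R, rfl⟩ := aux_factor S hS
  have hdet : IsUnit (Rᵀ * R) := hS.isUnit
  have hM : R * D ≠ 0 := by
    intro h
    apply hD
    have h2 : (Rᵀ * R) * D = 0 := by rw [Matrix.mul_assoc, h, Matrix.mul_zero]
    have h3 := congrArg (fun X => (Rᵀ * R)⁻¹ * X) h2
    simpa [← Matrix.mul_assoc, 
      Matrix.nonsing_inv_mul _ ((Matrix.isUnit_iff_isUnit_det _).mp hdet)] using h3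
  have e : (A * Dᵀ * (Rᵀ * R) * D).trace = ((R * D) * (A * (R * D)ᵀ)).trace := by
    rw [Matrix.trace_mul_comm (R * D), Matrix.transpose_mul]
    simp only [Matrix.mul_assoc]
  rw [e]
  have e2 : ((R * D) * (A * (R * D)ᵀ)).trace
      = ∑ i, ((R * D) i) ⬝ᵥ (A *ᵥ ((R * D) i)) := rfl
  rw [e2]
  obtain ⟨i, hi⟩ : ∃ i, (R * D) i ≠ 0 := by
    by_contra! h
    exact hM (by ext i j; rw [h i]; rfl)
  apply Finset.sum_pos' _ ⟨i, Finset.mem_univ _, hA _ hi⟩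
  intro j _
  by_cases hj : (R * D) j = 0
  · rw [hj]; simp
  · exact (hA _ hj).le

lemma aux_quad {n : ℕ} (α β φ : Fin n → ℝ)
    (hα : ∀ i, 0 < α i) (hβ : ∀ i, 0 < β i)
    (hφ : ∀ i, 0 < φ i) (x : Fin n → ℝ) (hx : x ≠ 0) :
    0 < x ⬝ᵥ (((Matrix.diagonal α + Matrix.diagonal φ) * Matrix.diagonal β
      + ((∑ i, β i * φ i) • (1 : Matrix (Fin n) (Fin n) ℝ) - 2 • Matrix.diagonal φ)
        * vecMulVec β β) *ᵥ x) := by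
  have e : x ⬝ᵥ (((Matrix.diagonal α + Matrix.diagonal φ) * Matrix.diagonal β
      + ((∑ i, β i * φ i) • (1 : Matrix (Fin n) (Fin n) ℝ) - 2 • Matrix.diagonal φ)
        * vecMulVec β β) *ᵥ x)
      = ∑ i, (α i * β i * x i ^ 2 + β i * φ i * (x i - β ⬝ᵥ x) ^ 2) := by
    have e1 : ∀ i, (((Matrix.diagonal α + Matrix.diagonal φ) * Matrix.diagonal β
      + ((∑ i, β i * φ i) • (1 : Matrix (Fin n) (Fin n) ℝ) - 2 • Matrix.diagonal φ)
        * vecMulVec β β) *ᵥ x) i = (α i + φ i) * β i * x i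
          + ((∑ i, β i * φ i) * β i - 2 * (φ i * β i)) * (β ⬝ᵥ x) := by
      intro i
      rw [Matrix.diagonal_add, Matrix.diagonal_mul_diagonal, Matrix.add_mulVec,
        Matrix.mul_vecMulVec, Matrix.vecMulVec_mulVec, Matrix.sub_mulVec, Matrix.smul_mulVec,
        Matrix.smul_mulVec, Matrix.one_mulVec]
      simp [Matrix.mulVec_diagonal]
      ring
    have hs : ∑ i, β i * x i = β ⬝ᵥ x := rfl
    have e2 : x ⬝ᵥ (((Matrix.diagonal α + Matrix.diagonal φ) * Matrix.diagonal β
      + ((∑ i, β i * φ i) • (1 : Matrix (Fin n) (Fin n) ℝ) - 2 • Matrix.diagonal φ)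
        * vecMulVec β β) *ᵥ x) = ∑ i, x i * ((α i + φ i) * β i * x i
          + ((∑ i, β i * φ i) * β i - 2 * (φ i * β i)) * (β ⬝ᵥ x)) :=
      Finset.sum_congr rfl fun i _ => by rw [e1 i]
    rw [e2]
    generalize β ⬝ᵥ x = s at *
    generalize hp : ∑ i, β i * φ i = p at *
    have e3 : ∑ i, x i * ((α i + φ i) * β i * x i + (p * β i - 2 * (φ i * β i)) * s)
        - ∑ i, (α i * β i * x i ^ 2 + β i * φ i * (x i - s) ^ 2)
        = ∑ i, (p * s * (β i * x i) - s ^ 2 * (β i * φ i)) := by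
      rw [← Finset.sum_sub_distrib]
      exact Finset.sum_congr rfl fun i _ => by ring
    rw [Finset.sum_sub_distrib, ← Finset.mul_sum, ← Finset.mul_sum, hs, hp] at e3
    linarith
  rw [e]
  obtain ⟨i, hi⟩ : ∃ i, x i ≠ 0 := by
    by_contra! h
    exact hx (funext h)
  apply Finset.sum_pos'
  · intro j _
    have := hα j; have := hβ j; have := hφ j
    positivity
  · refine ⟨i, Finset.mem_univ _, ?_⟩
    have := hα i; have := hβ i; have := hφ i
    positivity

/-- Theorem 1, optimal weights: `W* = ω_GMV 1_n' + (Qμ)(β' A_φ⁻¹)` is the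
unique maximizer of `W ↦ β'W'μ − (1/2) tr(A W'ΣW)` over all k×n matrices with `W'1_k = 1_n`. -/
theorem mimicking_optimal_weights_unique_maximizer
    {k n : ℕ} (hk : 2 ≤ k) (hn : 2 ≤ n)
    (S : Matrix (Fin k) (Fin k) ℝ) (hS : S.PosDef)
    (μ : Fin k → ℝ)
    (α β φ : Fin n → ℝ)
    (hα : ∀ i, 0 < α i) (hβ : ∀ i, 0 < β i) (hβsum : ∑ i, β i = 1)
    (hφ : ∀ i, 0 < φ i) :
    let onek : Fin k → ℝ := fun _ => 1
    let onen : Fin n → ℝ := fun _ => 1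
    let c : ℝ := onek ⬝ᵥ (S⁻¹ *ᵥ onek)
    let ωGMV : Fin k → ℝ := c⁻¹ • (S⁻¹ *ᵥ onek)
    let Q : Matrix (Fin k) (Fin k) ℝ := S⁻¹ - c⁻¹ • vecMulVec (S⁻¹ *ᵥ onek) (onek ᵥ* S⁻¹)
    let A₀ : Matrix (Fin n) (Fin n) ℝ := Matrix.diagonal α
    let B : Matrix (Fin n) (Fin n) ℝ := Matrix.diagonal β
    let Φ : Matrix (Fin n) (Fin n) ℝ := Matrix.diagonal φ
    let φbar : ℝ := ∑ i, β i * φ i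
    let A : Matrix (Fin n) (Fin n) ℝ :=
      (A₀ + Φ) * B + (φbar • (1 : Matrix (Fin n) (Fin n) ℝ) - 2 • Φ) * vecMulVec β β
    let Aφ : Matrix (Fin n) (Fin n) ℝ := (1 / 2 : ℝ) • (A + Aᵀ)
    let Wstar : Matrix (Fin k) (Fin n) ℝ :=
      vecMulVec ωGMV onen + vecMulVec (Q *ᵥ μ) (β ᵥ* Aφ⁻¹)
    let f : Matrix (Fin k) (Fin n) ℝ → ℝ :=
      fun W => β ⬝ᵥ (Wᵀ *ᵥ μ) - (1 / 2) * (A * Wᵀ * S * W).trace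
    Wstarᵀ *ᵥ onek = onen ∧
      ∀ W : Matrix (Fin k) (Fin n) ℝ, Wᵀ *ᵥ onek = onen → W ≠ Wstar → f W < f Wstar := by
  intro onek onen c ωGMV Q A₀ B Φ φbar A Aφ Wstar f
  have hA : ∀ x : Fin n → ℝ, x ≠ 0 → 0 < x ⬝ᵥ (A *ᵥ x) := aux_quad α β φ hα hβ hφ
  have hAφ : Aφ.PosDef := by
    apply Matrix.PosDef.of_dotProduct_mulVec_pos
    · ext i j
      simp [Aφ, add_comm]
    · intro x hx
      have h1 : x ⬝ᵥ (Aᵀ *ᵥ x) = x ⬝ᵥ (A *ᵥ x) := by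
        rw [Matrix.mulVec_transpose, dotProduct_comm, Matrix.dotProduct_mulVec]
      have h2 := hA x hx
      simp only [Aφ, star_trivial, Matrix.smul_mulVec, Matrix.add_mulVec, dotProduct_smul,
        dotProduct_add, h1, smul_eq_mul]
      linarith
  have hAu : IsUnit Aφ.det := (Matrix.isUnit_iff_isUnit_det _).mp hAφ.isUnit
  have hSu : IsUnit S.det := (Matrix.isUnit_iff_isUnit_det _).mp hS.isUnit
  have hSt : Sᵀ = S := by
    simpa [conjTranspose_eq_transpose_of_trivial] using hS.isHermitian.eq
  have hone : onek ≠ 0 := by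
    intro h
    have := congrFun h ⟨0, by omega⟩
    simp [onek] at this
  have hc : c ≠ 0 := (hS.inv.dotProduct_mulVec_pos hone).ne'
  have hSω : S *ᵥ ωGMV = c⁻¹ • onek := by
    simp only [ωGMV, Matrix.mulVec_smul, Matrix.mulVec_mulVec, Matrix.mul_nonsing_inv _ hSu,
      Matrix.one_mulVec]
  have hSQ : S *ᵥ (Q *ᵥ μ) = μ - (c⁻¹ * ((onek ᵥ* S⁻¹) ⬝ᵥ μ)) • onek := by
    simp only [Q, Matrix.sub_mulVec, Matrix.smul_mulVec, Matrix.vecMulVec_mulVec,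
      Matrix.mulVec_sub, Matrix.mulVec_smul, Matrix.mulVec_mulVec, Matrix.mul_nonsing_inv _ hSu,
      Matrix.one_mulVec, op_smul_eq_smul, smul_smul]
  have h1ω : ωGMV ⬝ᵥ onek = 1 := by
    simp only [ωGMV, smul_dotProduct, smul_eq_mul]
    rw [dotProduct_comm]
    exact inv_mul_cancel₀ hc
  have h1Q : (Q *ᵥ μ) ⬝ᵥ onek = 0 := by
    simp only [Q, Matrix.sub_mulVec, Matrix.smul_mulVec, Matrix.vecMulVec_mulVec,
      op_smul_eq_smul, sub_dotProduct, smul_dotProduct, smul_eq_mul]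
    rw [dotProduct_comm (S⁻¹ *ᵥ onek), dotProduct_comm (S⁻¹ *ᵥ μ), Matrix.dotProduct_mulVec]
    change _ - c⁻¹ * (_ * c) = 0
    field_simp
    ring
  have hW1 : Wstarᵀ *ᵥ onek = onen := by
    simp only [Wstar, Matrix.transpose_add, Matrix.transpose_vecMulVec, Matrix.add_mulVec,
      Matrix.vecMulVec_mulVec, h1ω, h1Q, op_smul_eq_smul]
    simp
  refine ⟨hW1, ?_⟩
  intro W hW hne
  obtain ⟨D, rfl⟩ : ∃ D, W = Wstar + D := ⟨W - Wstar, by abel⟩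
  have hD : D ≠ 0 := by
    rintro rfl
    simp at hne
  have hD1 : Dᵀ *ᵥ onek = 0 := by
    rw [Matrix.transpose_add, Matrix.add_mulVec, hW1] at hW
    simpa using hW
  have hpos := aux_trace_pos S hS A hA D hD
  have hSW : Dᵀ * S * Wstar = vecMulVec (Dᵀ *ᵥ μ) (β ᵥ* Aφ⁻¹) := by
    rw [Matrix.mul_assoc]
    simp only [Wstar, Matrix.mul_add, Matrix.mul_vecMulVec, hSω, hSQ, Matrix.mulVec_smul,
      Matrix.mulVec_sub, hD1, smul_zero, sub_zero, Matrix.zero_vecMulVec, zero_add]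
  have hcross : (Aφ * (Dᵀ * S * Wstar)).trace = β ⬝ᵥ (Dᵀ *ᵥ μ) := by
    rw [hSW, Matrix.trace_mul_comm, Matrix.vecMulVec_mul, Matrix.vecMul_vecMul,
      Matrix.nonsing_inv_mul _ hAu, Matrix.vecMul_one, Matrix.trace_vecMulVec, dotProduct_comm]
  have hc2 : (A * (Wstarᵀ * S * D)).trace = (Aᵀ * (Dᵀ * S * Wstar)).trace := by
    rw [← Matrix.trace_transpose, Matrix.trace_mul_comm Aᵀ]
    simp only [Matrix.transpose_mul, Matrix.transpose_transpose, hSt, Matrix.mul_assoc]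
  have hc3 : (A * (Dᵀ * S * Wstar)).trace + (A * (Wstarᵀ * S * D)).trace
      = 2 * (β ⬝ᵥ (Dᵀ *ᵥ μ)) := by
    rw [hc2, ← hcross, ← Matrix.trace_add, ← Matrix.add_mul]
    simp only [Aφ, Matrix.smul_mul, Matrix.trace_smul, smul_eq_mul]
    ring
  simp only [f, Matrix.transpose_add, Matrix.add_mulVec, dotProduct_add, Matrix.mul_add,
    Matrix.add_mul, Matrix.trace_add]
  simp only [Matrix.mul_assoc] at hc3 hpos ⊢
  linarith
end

section
/- Let ω*_f = ω_GMV + (β' A_φ⁻¹ β) Q μ be the mimicking optimal fund portfolio. Then its mean is (ω*_f)'μ = μ_GMV + (β' A_φ⁻¹ β) μ'Qμ and its variance is (ω*_f)'Σ(ω*_f) = V_GMV + (β' A_φ⁻¹ β)² μ'Qμ, where μ_GMV = μ'Σ⁻¹1/(1'Σ⁻¹1) and V_GMV = 1/(1'Σ⁻¹1). -/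
open Matrix BigOperators

/-- The mimicking optimal fund portfolio `ω*_f = ω_GMV + (β' A_φ⁻¹ β) Q μ` has
mean `μ_GMV + (β' A_φ⁻¹ β) μ'Qμ` and variance `V_GMV + (β' A_φ⁻¹ β)² μ'Qμ`. -/
theorem mimicking_fund_mean_variance
    {k n : ℕ} (hk : 2 ≤ k) (hn : 2 ≤ n)
    (S : Matrix (Fin k) (Fin k) ℝ) (hS : S.PosDef)
    (μ : Fin k → ℝ)
    (α β φ : Fin n → ℝ)
    (hα : ∀ i, 0 < α i) (hβ : ∀ i, 0 < β i) (hβsum : ∑ i, β i = 1)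
    (hφ : ∀ i, 0 < φ i) :
    let onek : Fin k → ℝ := fun _ => 1
    let c : ℝ := onek ⬝ᵥ (S⁻¹ *ᵥ onek)
    let ωGMV : Fin k → ℝ := c⁻¹ • (S⁻¹ *ᵥ onek)
    let Q : Matrix (Fin k) (Fin k) ℝ := S⁻¹ - c⁻¹ • vecMulVec (S⁻¹ *ᵥ onek) (onek ᵥ* S⁻¹)
    let A₀ : Matrix (Fin n) (Fin n) ℝ := Matrix.diagonal α
    let B : Matrix (Fin n) (Fin n) ℝ := Matrix.diagonal β
    let Φ : Matrix (Fin n) (Fin n) ℝ := Matrix.diagonal φ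
    let φbar : ℝ := ∑ i, β i * φ i
    let A : Matrix (Fin n) (Fin n) ℝ :=
      (A₀ + Φ) * B + (φbar • (1 : Matrix (Fin n) (Fin n) ℝ) - 2 • Φ) * vecMulVec β β
    let Aφ : Matrix (Fin n) (Fin n) ℝ := (1 / 2 : ℝ) • (A + Aᵀ)
    let ωf : Fin k → ℝ := ωGMV + (β ⬝ᵥ (Aφ⁻¹ *ᵥ β)) • (Q *ᵥ μ)
    let μGMV : ℝ := c⁻¹ * (μ ⬝ᵥ (S⁻¹ *ᵥ onek))
    let VGMV : ℝ := c⁻¹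
    ωf ⬝ᵥ μ = μGMV + (β ⬝ᵥ (Aφ⁻¹ *ᵥ β)) * (μ ⬝ᵥ (Q *ᵥ μ)) ∧
      ωf ⬝ᵥ (S *ᵥ ωf) = VGMV + (β ⬝ᵥ (Aφ⁻¹ *ᵥ β)) ^ 2 * (μ ⬝ᵥ (Q *ᵥ μ)) := by
  intro onek c ωGMV Q A₀ B Φ φbar A Aφ ωf μGMV VGMV
  have hdet : IsUnit S.det := hS.det_pos.ne'.isUnit
  have hST : (S⁻¹)ᵀ = S⁻¹ := by
    have h := hS.inv.isHermitian.eq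
    simpa [Matrix.conjTranspose_eq_transpose_of_trivial] using h
  have hc : c ≠ 0 := by
    have hne : onek ≠ 0 := by
      intro h
      have := congrFun h ⟨0, by omega⟩
      simp [onek] at this
    have h := hS.inv.dotProduct_mulVec_pos hne
    simp only [star_trivial] at h
    exact h.ne'
  have hvm : onek ᵥ* S⁻¹ = S⁻¹ *ᵥ onek := by
    rw [← Matrix.mulVec_transpose, hST]
  have hSu : S *ᵥ (S⁻¹ *ᵥ onek) = onek := by
    rw [Matrix.mulVec_mulVec, Matrix.mul_nonsing_inv _ hdet, Matrix.one_mulVec]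
  have hSv : S *ᵥ (S⁻¹ *ᵥ μ) = μ := by
    rw [Matrix.mulVec_mulVec, Matrix.mul_nonsing_inv _ hdet, Matrix.one_mulVec]
  have hv1 : (S⁻¹ *ᵥ μ) ⬝ᵥ onek = μ ⬝ᵥ (S⁻¹ *ᵥ onek) := by
    rw [dotProduct_comm, Matrix.dotProduct_mulVec, hvm, dotProduct_comm]
  have hu1 : (S⁻¹ *ᵥ onek) ⬝ᵥ onek = c := dotProduct_comm _ _
  have hQ : Q *ᵥ μ = S⁻¹ *ᵥ μ - (c⁻¹ * (μ ⬝ᵥ (S⁻¹ *ᵥ onek))) • (S⁻¹ *ᵥ onek) := by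
    simp only [Q, Matrix.sub_mulVec, Matrix.smul_mulVec, Matrix.vecMulVec_mulVec, hvm]
    ext i
    simp [dotProduct_comm (S⁻¹ *ᵥ onek) μ]
    ring
  have hum : (S⁻¹ *ᵥ onek) ⬝ᵥ μ = μ ⬝ᵥ (S⁻¹ *ᵥ onek) := dotProduct_comm _ _
  have hvmu : (S⁻¹ *ᵥ μ) ⬝ᵥ μ = μ ⬝ᵥ (S⁻¹ *ᵥ μ) := dotProduct_comm _ _
  simp only [ωf, ωGMV, μGMV, VGMV]
  generalize β ⬝ᵥ (Aφ⁻¹ *ᵥ β) = t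
  rw [hQ]
  clear_value c
  generalize S⁻¹ *ᵥ onek = u at *
  generalize S⁻¹ *ᵥ μ = v at *
  simp only [Matrix.mulVec_add, Matrix.mulVec_sub, Matrix.mulVec_smul, hSu, hSv,
    add_dotProduct, dotProduct_add, sub_dotProduct, dotProduct_sub, smul_dotProduct,
    dotProduct_smul, smul_eq_mul, hu1, hv1, hum, hvmu]
  constructor
  · trivial
  · field_simp
    ring
end

section
/- (Corollary 1b) Suppose all mimicking coefficients are equal, φᵢ = φ > 0 for all i. Then the mimicking matrix A = (A₀ + φ I)B − φ ββ' is symmetric and positive definite, and the mimicking optimal fund portfolio equals ω*_f = ω_GMV + (β' A⁻¹ β) Q μ. -/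
open Matrix BigOperators

lemma psd_aux {n : ℕ} (β : Fin n → ℝ) (hβ : ∀ i, 0 < β i) (hs : ∑ i, β i = 1) :
    (Matrix.diagonal β - vecMulVec β β).PosSemidef := by
  refine Matrix.PosSemidef.of_dotProduct_mulVec_nonneg ?_ ?_
  · ext i j
    by_cases h : i = j
    · subst h; simp [vecMulVec_apply]
    · simp [vecMulVec_apply, Matrix.diagonal_apply, h, Ne.symm h, mul_comm]
  · intro x
    have h1 : star x ⬝ᵥ ((Matrix.diagonal β - vecMulVec β β) *ᵥ x)
        = ∑ i, β i * x i ^ 2 - (∑ i, β i * x i) ^ 2 := by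
      rw [Matrix.sub_mulVec, dotProduct_sub]
      congr 1
      · simp only [dotProduct, mulVec_diagonal, star_trivial]
        exact Finset.sum_congr rfl fun i _ => by ring
      · rw [vecMulVec_mulVec]
        simp only [dotProduct, star_trivial, sq, Finset.sum_mul, Pi.smul_apply,
          MulOpposite.smul_eq_mul_unop, MulOpposite.unop_op]
        exact Finset.sum_congr rfl fun i _ => by ring
    rw [h1]
    obtain ⟨m, hm⟩ : ∃ m, m = ∑ i, β i * x i := ⟨_, rfl⟩
    rw [← hm]
    have h2 : 0 ≤ ∑ i, β i * (x i - m) ^ 2 :=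
      Finset.sum_nonneg fun i _ => mul_nonneg (hβ i).le (sq_nonneg _)
    have h3 : ∑ i, β i * (x i - m) ^ 2
        = ∑ i, β i * x i ^ 2 - 2 * m * (∑ i, β i * x i) + m ^ 2 * ∑ i, β i := by
      rw [Finset.mul_sum, Finset.mul_sum, ← Finset.sum_sub_distrib, ← Finset.sum_add_distrib]
      exact Finset.sum_congr rfl fun i _ => by ring
    rw [h3, hs, ← hm] at h2
    nlinarith

/-- Corollary 1b: With equal mimicking coefficients `φᵢ = φ > 0`, the
mimicking matrix reduces to `A = (A₀ + φI)B − φββ'`, which is symmetric and positive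
definite, and the mimicking optimal fund portfolio equals `ω*_f = ω_GMV + (β' A⁻¹ β) Q μ`. -/
theorem mimicking_fund_equal_mimicking_coefficients
    {k n : ℕ} (hk : 2 ≤ k) (hn : 2 ≤ n)
    (S : Matrix (Fin k) (Fin k) ℝ) (hS : S.PosDef)
    (μ : Fin k → ℝ)
    (α β : Fin n → ℝ)
    (hα : ∀ i, 0 < α i) (hβ : ∀ i, 0 < β i) (hβsum : ∑ i, β i = 1)
    (φ : ℝ) (hφ : 0 < φ) :
    let onek : Fin k → ℝ := fun _ => 1
    let c : ℝ := onek ⬝ᵥ (S⁻¹ *ᵥ onek)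
    let ωGMV : Fin k → ℝ := c⁻¹ • (S⁻¹ *ᵥ onek)
    let Q : Matrix (Fin k) (Fin k) ℝ := S⁻¹ - c⁻¹ • vecMulVec (S⁻¹ *ᵥ onek) (onek ᵥ* S⁻¹)
    let A₀ : Matrix (Fin n) (Fin n) ℝ := Matrix.diagonal α
    let B : Matrix (Fin n) (Fin n) ℝ := Matrix.diagonal β
    let Φ : Matrix (Fin n) (Fin n) ℝ := Matrix.diagonal (fun _ => φ)
    let φbar : ℝ := ∑ i, β i * φ
    let A : Matrix (Fin n) (Fin n) ℝ :=
      (A₀ + Φ) * B + (φbar • (1 : Matrix (Fin n) (Fin n) ℝ) - 2 • Φ) * vecMulVec β β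
    let Aφ : Matrix (Fin n) (Fin n) ℝ := (1 / 2 : ℝ) • (A + Aᵀ)
    A = (A₀ + φ • (1 : Matrix (Fin n) (Fin n) ℝ)) * B - φ • vecMulVec β β ∧
      A.IsSymm ∧ A.PosDef ∧
      ωGMV + (β ⬝ᵥ (Aφ⁻¹ *ᵥ β)) • (Q *ᵥ μ) = ωGMV + (β ⬝ᵥ (A⁻¹ *ᵥ β)) • (Q *ᵥ μ) := by
  intro onek c ωGMV Q A₀ B Φ φbar A Aφ
  have hbar : φbar = φ := by
    simp only [φbar]; rw [← Finset.sum_mul, hβsum, one_mul]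
  have hΦ : Φ = φ • (1 : Matrix (Fin n) (Fin n) ℝ) := by
    simp only [Φ]; rw [Matrix.smul_one_eq_diagonal]
  have hA : A = (A₀ + φ • (1 : Matrix (Fin n) (Fin n) ℝ)) * B - φ • vecMulVec β β := by
    simp only [A]
    rw [hbar, hΦ, two_smul, sub_add_cancel_left, neg_mul, smul_mul_assoc, one_mul, ← sub_eq_add_neg]
  have hA2 : A = Matrix.diagonal (fun i => α i * β i)
      + φ • (Matrix.diagonal β - vecMulVec β β) := by
    rw [hA]
    simp only [A₀, B]
    rw [add_mul, Matrix.diagonal_mul_diagonal, smul_mul_assoc, one_mul, smul_sub, add_sub_assoc]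
  have hpd : A.PosDef := by
    rw [hA2]
    exact (Matrix.PosDef.diagonal fun i => mul_pos (hα i) (hβ i)).add_posSemidef
      ((psd_aux β hβ hβsum).smul hφ.le)
  have hsym : Aᵀ = A := by
    have := hpd.isHermitian
    rwa [Matrix.IsHermitian, Matrix.conjTranspose_eq_transpose_of_trivial] at this
  have hAφ : Aφ = A := by
    simp only [Aφ]
    rw [hsym, ← two_smul ℝ A, smul_smul]
    norm_num
  exact ⟨hA, hsym, hpd, by rw [hAφ]⟩
end

section
/- (Corollary 1c) Suppose all investors have the same risk aversion and mimicking coefficient, αᵢ = α > 0 and φᵢ = φ > 0 for all i. Then β' A_φ⁻¹ β = α⁻¹, so the mimicking optimal fund portfolio coincides with the non-mimicking mean–variance solution: ω*_f = ω_GMV + α⁻¹ Q μ. -/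
open Matrix BigOperators

/-- Corollary 1c: With common risk aversion `α > 0` and common mimicking
coefficient `φ > 0`, one has `β' A_φ⁻¹ β = α⁻¹`, so the mimicking optimal fund portfolio
coincides with the non-mimicking mean-variance solution `ω_GMV + α⁻¹ Q μ`. -/
theorem mimicking_fund_identical_investors
    {k n : ℕ} (hk : 2 ≤ k) (hn : 2 ≤ n)
    (S : Matrix (Fin k) (Fin k) ℝ) (hS : S.PosDef)
    (μ : Fin k → ℝ)
    (β : Fin n → ℝ) (hβ : ∀ i, 0 < β i) (hβsum : ∑ i, β i = 1)
    (α φ : ℝ) (hα : 0 < α) (hφ : 0 < φ) :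
    let onek : Fin k → ℝ := fun _ => 1
    let c : ℝ := onek ⬝ᵥ (S⁻¹ *ᵥ onek)
    let ωGMV : Fin k → ℝ := c⁻¹ • (S⁻¹ *ᵥ onek)
    let Q : Matrix (Fin k) (Fin k) ℝ := S⁻¹ - c⁻¹ • vecMulVec (S⁻¹ *ᵥ onek) (onek ᵥ* S⁻¹)
    let A₀ : Matrix (Fin n) (Fin n) ℝ := Matrix.diagonal (fun _ => α)
    let B : Matrix (Fin n) (Fin n) ℝ := Matrix.diagonal β
    let Φ : Matrix (Fin n) (Fin n) ℝ := Matrix.diagonal (fun _ => φ)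
    let φbar : ℝ := ∑ i, β i * φ
    let A : Matrix (Fin n) (Fin n) ℝ :=
      (A₀ + Φ) * B + (φbar • (1 : Matrix (Fin n) (Fin n) ℝ) - 2 • Φ) * vecMulVec β β
    let Aφ : Matrix (Fin n) (Fin n) ℝ := (1 / 2 : ℝ) • (A + Aᵀ)
    β ⬝ᵥ (Aφ⁻¹ *ᵥ β) = α⁻¹ ∧
      ωGMV + (β ⬝ᵥ (Aφ⁻¹ *ᵥ β)) • (Q *ᵥ μ) = ωGMV + α⁻¹ • (Q *ᵥ μ) := by
  intro onek c ωGMV Q A₀ B Φ φbar A Aφ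
  have hbar : φbar = φ := by
    simp only [φbar, ← Finset.sum_mul, hβsum, one_mul]
  have hA : A = (α + φ) • Matrix.diagonal β - φ • vecMulVec β β := by
    simp only [A, hbar]
    ext i j
    have h1 : φ • (1 : Matrix (Fin n) (Fin n) ℝ) - 2 • Φ = Matrix.diagonal (fun _ => -φ) := by
      rw [two_smul]
      ext i j
      by_cases h : i = j
      · subst h
        simp [Φ]
      · simp [Φ, h]
    rw [h1]
    simp only [A₀, Φ, B, Matrix.diagonal_add, Matrix.diagonal_mul_diagonal, Matrix.add_apply,
      Matrix.sub_apply, Matrix.smul_apply, Matrix.diagonal_mul, vecMulVec_apply, smul_eq_mul]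
    by_cases h : i = j
    · subst h
      simp
      ring
    · simp [h]
  have hAφ : ∀ i j, Aφ i j = (α + φ) * (if i = j then β i else 0) - φ * (β i * β j) := by
    intro i j
    simp only [Aφ, hA, Matrix.add_apply, Matrix.transpose_apply,
      Matrix.sub_apply, Matrix.smul_apply, vecMulVec_apply, smul_eq_mul]
    by_cases h : i = j
    · subst h
      simp
      ring
    · have h' : ¬ j = i := fun e => h e.symm
      simp [h, h']
      ring
  have hαφ : α + φ ≠ 0 := by positivity
  have hα0 : α ≠ 0 := hα.ne'
  have hinv : Aφ * (Matrix.of fun i j =>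
      (α + φ)⁻¹ * ((if i = j then (β j)⁻¹ else 0) + φ / α)) = 1 := by
    ext i j
    rw [Matrix.mul_apply]
    simp only [hAφ, Matrix.of_apply]
    have e : ∀ x, ((α + φ) * (if i = x then β i else 0) - φ * (β i * β x)) *
        ((α + φ)⁻¹ * ((if x = j then (β j)⁻¹ else 0) + φ / α)) =
        (if i = x then β i * ((if x = j then (β j)⁻¹ else 0) + φ / α) else 0)
        - (if x = j then φ * β i * (α + φ)⁻¹ * (β x * (β j)⁻¹) else 0)
        - (φ * β i * (α + φ)⁻¹ * (φ / α)) * β x := by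
      intro x
      split_ifs <;> field_simp <;> ring
    simp only [e, Finset.sum_sub_distrib, ← Finset.mul_sum, hβsum, Finset.sum_ite_eq,
      Finset.sum_ite_eq', Finset.mem_univ, if_true, Matrix.one_apply]
    have hj := (hβ j).ne'
    by_cases h : i = j
    · subst h
      simp only [if_true]
      field_simp
      ring
    · simp only [h, if_false]
      field_simp
      ring
  have hu : IsUnit Aφ.det := Matrix.isUnit_det_of_right_inverse hinv
  have hone : Aφ *ᵥ (fun _ => α⁻¹) = β := by
    ext i
    simp only [Matrix.mulVec, dotProduct, hAφ, ← Finset.sum_mul, Finset.sum_sub_distrib,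
      ← Finset.mul_sum, hβsum, Finset.sum_ite_eq, Finset.mem_univ, if_true]
    field_simp
    ring
  have hsol : Aφ⁻¹ *ᵥ β = fun _ => α⁻¹ := by
    conv_lhs => rw [← hone]
    rw [Matrix.mulVec_mulVec, Matrix.nonsing_inv_mul _ hu, Matrix.one_mulVec]
  have key : β ⬝ᵥ (Aφ⁻¹ *ᵥ β) = α⁻¹ := by
    rw [hsol]
    simp only [dotProduct, ← Finset.sum_mul, hβsum, one_mul]
  exact ⟨key, by rw [key]⟩
end

section
/- Let βᵢ > 0 with Σᵢ βᵢ = 1 and φᵢ ≥ φ_min ≥ 0 for i = 1,…,n, and let φ̄ = Σᵢ βᵢφᵢ. Then for every ξ ∈ ℝⁿ, Σᵢ φᵢβᵢξᵢ² + φ̄ (Σᵢ βᵢξᵢ)² − 2 (Σᵢ φᵢβᵢξᵢ)(Σᵢ βᵢξᵢ) ≥ φ_min ( Σᵢ βᵢξᵢ² − (Σᵢ βᵢξᵢ)² ) ≥ 0. -/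
open BigOperators

/-- For weights `βᵢ > 0` summing to one and coefficients `φᵢ ≥ φ_min ≥ 0`,
for every `ξ ∈ ℝⁿ`,
`Σᵢ φᵢβᵢξᵢ² + φ̄(Σᵢ βᵢξᵢ)² − 2(Σᵢ φᵢβᵢξᵢ)(Σᵢ βᵢξᵢ) ≥ φ_min(Σᵢ βᵢξᵢ² − (Σᵢ βᵢξᵢ)²) ≥ 0`. -/
theorem mimicking_quadratic_form_inequality
    {n : ℕ} (hn : 2 ≤ n)
    (β φ : Fin n → ℝ) (φmin : ℝ)
    (hβ : ∀ i, 0 < β i) (hβsum : ∑ i, β i = 1)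
    (hφmin : 0 ≤ φmin) (hφ : ∀ i, φmin ≤ φ i) :
    ∀ ξ : Fin n → ℝ,
      φmin * (∑ i, β i * ξ i ^ 2 - (∑ i, β i * ξ i) ^ 2)
          ≤ ∑ i, φ i * β i * ξ i ^ 2 + (∑ i, β i * φ i) * (∑ i, β i * ξ i) ^ 2
            - 2 * (∑ i, φ i * β i * ξ i) * (∑ i, β i * ξ i) ∧
        0 ≤ φmin * (∑ i, β i * ξ i ^ 2 - (∑ i, β i * ξ i) ^ 2) := by
  intro ξ
  set c := ∑ i, β i * ξ i with hc
  have h1 : ∑ i, φ i * β i * (ξ i - c) ^ 2 = ∑ i, φ i * β i * ξ i ^ 2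
      + (∑ i, β i * φ i) * c ^ 2 - 2 * (∑ i, φ i * β i * ξ i) * c := by
    rw [Finset.sum_mul, mul_assoc, Finset.sum_mul, Finset.mul_sum, ← Finset.sum_add_distrib,
      ← Finset.sum_sub_distrib]
    exact Finset.sum_congr rfl fun i _ => by ring
  have h2 : ∑ i, β i * (ξ i - c) ^ 2 = ∑ i, β i * ξ i ^ 2 - c ^ 2 := by
    have h3 : ∑ i, β i * (ξ i - c) ^ 2 = ∑ i, β i * ξ i ^ 2
        + (∑ i, β i) * c ^ 2 - 2 * ((∑ i, β i * ξ i) * c) := by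
      rw [Finset.sum_mul, Finset.sum_mul, Finset.mul_sum, ← Finset.sum_add_distrib,
        ← Finset.sum_sub_distrib]
      exact Finset.sum_congr rfl fun i _ => by ring
    rw [h3, hβsum, ← hc]
    ring
  rw [← h1, ← h2]
  constructor
  · rw [Finset.mul_sum]
    refine Finset.sum_le_sum fun i _ => ?_
    rw [mul_assoc (φ i)]
    exact mul_le_mul_of_nonneg_right (hφ i) (mul_nonneg (hβ i).le (sq_nonneg _))
  · exact mul_nonneg hφmin (Finset.sum_nonneg fun i _ => mul_nonneg (hβ i).le (sq_nonneg _))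
end
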